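/- Let k_R ∈ G(Ω×Ω) and let R: G_c(Ω) → G(Ω) be the integral operator Ru(x) = ∫_Ω k_R(x,y)u(y)dy, with transpose ᵗRu(y) = ∫_Ω k_R(x,y)u(x)dx; extend R to L(G(Ω),ℂ̃) by RT(u) := T(ᵗRu) for u ∈ G_c(Ω). If T ∈ L(G(Ω),ℂ̃) is basic, then RT is the generalized function x ↦ T(k_R(x,·)) ∈ G(Ω): RT(u) = ∫_Ω T(k_R(x,·))u(x)dx for all u ∈ G_c(Ω). In particular, operators with kernel in G(Ω×Ω) map basic functionals of L(G(Ω),ℂ̃) into G(Ω). -/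

import Mathlib

noncomputable section

open Set MeasureTheory Topology

/-- Euclidean space `ℝ^n`. -/
abbrev Rn (n : ℕ) := EuclideanSpace ℝ (Fin n)

namespace Colombeau

/-- A net of smooth functions on the open set `Ω ⊆ E` is *moderate*:
for every compact `K ⊆ Ω` and derivative order `i` there is `N` with
`sup_{x∈K} ‖∂^i u_ε(x)‖ = O(ε^{-N})` as `ε → 0`. -/
def IsModerate {E : Type} [NormedAddCommGroup E] [NormedSpace ℝ E]
    (Ω : Set E) (u : ℝ → E → ℂ) : Prop :=
  (∀ ε ∈ Ioc (0:ℝ) 1, ContDiffOn ℝ (⊤ : ℕ∞) (u ε) Ω) ∧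
  ∀ K : Set E, IsCompact K → K ⊆ Ω → ∀ i : ℕ,
    ∃ N : ℕ, ∃ c > 0, ∃ η ∈ Ioc (0:ℝ) 1, ∀ ε ∈ Ioc (0:ℝ) η, ∀ x ∈ K,
      ‖iteratedFDeriv ℝ i (u ε) x‖ ≤ c * ε ^ (-(N:ℝ))

/-- A net of smooth functions on `Ω` is *negligible*:
for every compact `K ⊆ Ω`, derivative order `i` and every `q`,
`sup_{x∈K} ‖∂^i u_ε(x)‖ = O(ε^q)` as `ε → 0`. -/
def IsNegligible {E : Type} [NormedAddCommGroup E] [NormedSpace ℝ E]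
    (Ω : Set E) (u : ℝ → E → ℂ) : Prop :=
  (∀ ε ∈ Ioc (0:ℝ) 1, ContDiffOn ℝ (⊤ : ℕ∞) (u ε) Ω) ∧
  ∀ K : Set E, IsCompact K → K ⊆ Ω → ∀ i : ℕ, ∀ q : ℕ,
    ∃ c > 0, ∃ η ∈ Ioc (0:ℝ) 1, ∀ ε ∈ Ioc (0:ℝ) η, ∀ x ∈ K,
      ‖iteratedFDeriv ℝ i (u ε) x‖ ≤ c * ε ^ (q:ℝ)

/-- `G^∞`-moderateness: on each compact set the exponent `N` is uniform in the
derivative order. -/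
def IsGinfModerate {E : Type} [NormedAddCommGroup E] [NormedSpace ℝ E]
    (Ω : Set E) (u : ℝ → E → ℂ) : Prop :=
  (∀ ε ∈ Ioc (0:ℝ) 1, ContDiffOn ℝ (⊤ : ℕ∞) (u ε) Ω) ∧
  ∀ K : Set E, IsCompact K → K ⊆ Ω → ∃ N : ℕ, ∀ i : ℕ,
    ∃ c > 0, ∃ η ∈ Ioc (0:ℝ) 1, ∀ ε ∈ Ioc (0:ℝ) η, ∀ x ∈ K,
      ‖iteratedFDeriv ℝ i (u ε) x‖ ≤ c * ε ^ (-(N:ℝ))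

/-- The net `u` has all its supports contained in one fixed compact subset of `Ω`. -/
def HasCmpSupp {E : Type} [NormedAddCommGroup E] [NormedSpace ℝ E]
    (Ω : Set E) (u : ℝ → E → ℂ) : Prop :=
  ∃ K : Set E, IsCompact K ∧ K ⊆ Ω ∧ ∀ ε ∈ Ioc (0:ℝ) 1, tsupport (u ε) ⊆ K

/-- Moderate nets of complex numbers (representatives of elements of `ℂ̃`). -/
def CIsModerate (z : ℝ → ℂ) : Prop :=
  ∃ N : ℕ, ∃ c > 0, ∃ η ∈ Ioc (0:ℝ) 1, ∀ ε ∈ Ioc (0:ℝ) η, ‖z ε‖ ≤ c * ε ^ (-(N:ℝ))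

/-- Negligible nets of complex numbers. -/
def CIsNegligible (z : ℝ → ℂ) : Prop :=
  ∀ q : ℕ, ∃ c > 0, ∃ η ∈ Ioc (0:ℝ) 1, ∀ ε ∈ Ioc (0:ℝ) η, ‖z ε‖ ≤ c * ε ^ (q:ℝ)

/-- `S` is a distribution on `Ω`: for each compact `K ⊆ Ω` it is continuous with respect
to some seminorm `sup_{x∈K, |α|≤j} |∂^α f(x)|` on smooth functions supported in `K`. -/
def IsDistributionOn {n : ℕ} (Ω : Set (Rn n)) (S : (Rn n → ℂ) →ₗ[ℂ] ℂ) : Prop :=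
  ∀ K : Set (Rn n), IsCompact K → K ⊆ Ω →
    ∃ j : ℕ, ∃ C : ℝ, 0 ≤ C ∧ ∀ f : Rn n → ℂ, ContDiffOn ℝ (⊤ : ℕ∞) f Ω → tsupport f ⊆ K →
      ∀ B : ℝ, (∀ x ∈ K, ∀ i ≤ j, ‖iteratedFDeriv ℝ i f x‖ ≤ B) → ‖S f‖ ≤ C * B

/-- `S` is a compactly supported distribution on `Ω`. -/
def IsCptSuppDistributionOn {n : ℕ} (Ω : Set (Rn n)) (S : (Rn n → ℂ) →ₗ[ℂ] ℂ) : Prop :=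
  ∃ K : Set (Rn n), IsCompact K ∧ K ⊆ Ω ∧
    ∃ j : ℕ, ∃ C : ℝ, 0 ≤ C ∧ ∀ f : Rn n → ℂ, ContDiffOn ℝ (⊤ : ℕ∞) f Ω →
      ∀ B : ℝ, (∀ x ∈ K, ∀ i ≤ j, ‖iteratedFDeriv ℝ i f x‖ ≤ B) → ‖S f‖ ≤ C * B

/-- A net of distributions on `Ω` defining a *basic* functional on `G_c(Ω)`:
for every compact `K ⊆ Ω` there are `j`, `N`, `η ∈ (0,1]` with
`|T_ε(f)| ≤ ε^{-N} sup_{x∈K,|α|≤j} |∂^α f(x)|` for all smooth `f` supported in `K`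
and all `ε ≤ η`. -/
def IsBasicNetC {n : ℕ} (Ω : Set (Rn n)) (T : ℝ → (Rn n → ℂ) →ₗ[ℂ] ℂ) : Prop :=
  (∀ ε ∈ Ioc (0:ℝ) 1, IsDistributionOn Ω (T ε)) ∧
  ∀ K : Set (Rn n), IsCompact K → K ⊆ Ω →
    ∃ j N : ℕ, ∃ η ∈ Ioc (0:ℝ) 1, ∀ ε ∈ Ioc (0:ℝ) η,
      ∀ f : Rn n → ℂ, ContDiffOn ℝ (⊤ : ℕ∞) f Ω → tsupport f ⊆ K →
        ∀ C : ℝ, 0 ≤ C → (∀ x ∈ K, ∀ i ≤ j, ‖iteratedFDeriv ℝ i f x‖ ≤ C) →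
          ‖T ε f‖ ≤ ε ^ (-(N:ℝ)) * C

/-- A net of compactly supported distributions on `Ω` defining a *basic* functional on
`G(Ω)`: there are a compact `K ⊆ Ω` and `j`, `N`, `η ∈ (0,1]` with
`|T_ε(f)| ≤ ε^{-N} sup_{x∈K,|α|≤j} |∂^α f(x)|` for all `f ∈ C^∞(Ω)` and all `ε ≤ η`. -/
def IsBasicNetE {n : ℕ} (Ω : Set (Rn n)) (T : ℝ → (Rn n → ℂ) →ₗ[ℂ] ℂ) : Prop :=
  (∀ ε ∈ Ioc (0:ℝ) 1, IsCptSuppDistributionOn Ω (T ε)) ∧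
  ∃ K : Set (Rn n), IsCompact K ∧ K ⊆ Ω ∧
    ∃ j N : ℕ, ∃ η ∈ Ioc (0:ℝ) 1, ∀ ε ∈ Ioc (0:ℝ) η,
      ∀ f : Rn n → ℂ, ContDiffOn ℝ (⊤ : ℕ∞) f Ω →
        ∀ C : ℝ, 0 ≤ C → (∀ x ∈ K, ∀ i ≤ j, ‖iteratedFDeriv ℝ i f x‖ ≤ C) →
          ‖T ε f‖ ≤ ε ^ (-(N:ℝ)) * C

end Colombeau

open Colombeau

namespace Colombeau

section Slices

variable {E : Type} [NormedAddCommGroup E] [NormedSpace ℝ E] {Ω : Set E} {k : E × E → ℂ}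

lemma contDiffOn_slice (hk : ContDiffOn ℝ (⊤ : ℕ∞) k (Ω ×ˢ Ω)) {x : E} (hx : x ∈ Ω) :
    ContDiffOn ℝ (⊤ : ℕ∞) (fun y => k (x, y)) Ω :=
  hk.comp (by fun_prop) fun _ hy => ⟨hx, hy⟩

lemma iteratedFDeriv_slice (hΩ : IsOpen Ω) (hk : ContDiffOn ℝ (⊤ : ℕ∞) k (Ω ×ˢ Ω)) {x y : E}
    (hx : x ∈ Ω) (hy : y ∈ Ω) (i : ℕ) :
    iteratedFDeriv ℝ i (fun y => k (x, y)) y =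
      (iteratedFDeriv ℝ i k (x, y)).compContinuousLinearMap
        fun _ => ContinuousLinearMap.inr ℝ E E := by
  set s : Set (E × E) := (fun p => p + (x, 0)) ⁻¹' (Ω ×ˢ Ω)
  have hs : IsOpen s := (hΩ.prod hΩ).preimage (by fun_prop)
  have hs' : IsOpen (ContinuousLinearMap.inr ℝ E E ⁻¹' s) :=
    hs.preimage (ContinuousLinearMap.inr ℝ E E).continuous
  have hf : ContDiffOn ℝ (⊤ : ℕ∞) (fun p => k (p + (x, 0))) s :=
    hk.comp (by fun_prop) fun _ hp => hp
  have hys : ContinuousLinearMap.inr ℝ E E y ∈ s := by simp [s, hx, hy]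
  have h := (ContinuousLinearMap.inr ℝ E E).iteratedFDerivWithin_comp_right hf
    hs.uniqueDiffOn hs'.uniqueDiffOn hys (i := i) (by exact_mod_cast le_top)
  rw [iteratedFDerivWithin_of_isOpen i hs' hys, iteratedFDerivWithin_of_isOpen i hs hys,
    iteratedFDeriv_comp_add_right] at h
  simpa [Function.comp_def] using h

lemma norm_iteratedFDeriv_slice_le (hΩ : IsOpen Ω) (hk : ContDiffOn ℝ (⊤ : ℕ∞) k (Ω ×ˢ Ω))
    {x y : E} (hx : x ∈ Ω) (hy : y ∈ Ω) (i : ℕ) :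
    ‖iteratedFDeriv ℝ i (fun y => k (x, y)) y‖ ≤ ‖iteratedFDeriv ℝ i k (x, y)‖ := by
  rw [iteratedFDeriv_slice hΩ hk hx hy]
  refine (ContinuousMultilinearMap.norm_compContinuousLinearMap_le _ _).trans ?_
  refine mul_le_of_le_one_right (norm_nonneg _) (Finset.prod_le_one (fun _ _ => norm_nonneg _) ?_)
  exact fun _ _ => ContinuousLinearMap.norm_inr_le_one ℝ E E

lemma continuousOn_iteratedFDeriv_slice (hΩ : IsOpen Ω)
    (hk : ContDiffOn ℝ (⊤ : ℕ∞) k (Ω ×ˢ Ω)) (i : ℕ) :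
    ContinuousOn (fun p : E × E => iteratedFDeriv ℝ i (fun y => k (p.1, y)) p.2) (Ω ×ˢ Ω) := by
  have hc : ContinuousOn (iteratedFDeriv ℝ i k) (Ω ×ˢ Ω) :=
    (hk.continuousOn_iteratedFDerivWithin (by exact_mod_cast le_top)
      (hΩ.prod hΩ).uniqueDiffOn).congr (iteratedFDerivWithin_of_isOpen i (hΩ.prod hΩ)).symm
  refine ((ContinuousMultilinearMap.compContinuousLinearMapL
    fun _ : Fin i => ContinuousLinearMap.inr ℝ E E).continuous.comp_continuousOn hc).congr ?_
  exact fun p hp => iteratedFDeriv_slice hΩ hk hp.1 hp.2 i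

end Slices

section ParametricIntegral

variable {E : Type} [NormedAddCommGroup E] [NormedSpace ℝ E] [ProperSpace E] {Ω : Set E}
  {P : Type} [TopologicalSpace P] [CompactSpace P]
  [MeasurableSpace P] [OpensMeasurableSpace P] {μ : Measure P} [IsFiniteMeasure μ]
  {φ : P → E → ℂ}

lemma integrable_of_continuous {G : Type*} [NormedAddCommGroup G] {f : P → G}
    (hf : Continuous f) : Integrable f μ :=
  hf.integrable_of_hasCompactSupport (HasCompactSupport.of_compactSpace f)

lemma hasFTaylorSeriesUpToOn_integral (hΩ : IsOpen Ω)
    (hφ : ∀ s, ContDiffOn ℝ (⊤ : ℕ∞) (φ s) Ω)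
    (hc : ∀ i : ℕ, ContinuousOn (fun q : P × E => iteratedFDeriv ℝ i (φ q.1) q.2) (univ ×ˢ Ω)) :
    HasFTaylorSeriesUpToOn (⊤ : ℕ∞) (fun y => ∫ s, φ s y ∂μ)
      (fun y m => ∫ s, iteratedFDeriv ℝ m (φ s) y ∂μ) Ω := by
  have hcont : ∀ (i : ℕ) {y : E}, y ∈ Ω → Continuous fun s => iteratedFDeriv ℝ i (φ s) y :=
    fun i y hy => (hc i).comp_continuous (f := fun s : P => (s, y)) (by fun_prop)
      fun s => ⟨mem_univ s, hy⟩
  have hderiv : ∀ (m : ℕ) {y : E}, y ∈ Ω →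
      HasFDerivAt (fun y => ∫ s, iteratedFDeriv ℝ m (φ s) y ∂μ)
        (∫ s, iteratedFDeriv ℝ (m + 1) (φ s) y ∂μ).curryLeft y := by
    intro m y hy
    obtain ⟨r, hr, hrΩ⟩ := Metric.nhds_basis_closedBall.mem_iff.1 (hΩ.mem_nhds hy)
    obtain ⟨C, hC⟩ := ((isCompact_univ (X := P)).prod
      (isCompact_closedBall y r)).exists_bound_of_continuousOn
      ((hc (m + 1)).mono (prod_mono_right hrΩ))
    let L := continuousMultilinearCurryLeftEquiv ℝ (fun _ : Fin (m + 1) => E) ℂ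
    have h := hasFDerivAt_integral_of_dominated_of_fderiv_le (𝕜 := ℝ) (μ := μ)
      (F := fun y s => iteratedFDeriv ℝ m (φ s) y)
      (F' := fun y s => L (iteratedFDeriv ℝ (m + 1) (φ s) y)) (bound := fun _ => C)
      (Metric.closedBall_mem_nhds y hr)
      ((hΩ.eventually_mem hy).mono fun z hz =>
        (integrable_of_continuous (hcont m hz)).aestronglyMeasurable)
      (integrable_of_continuous (hcont m hy))
      (integrable_of_continuous
        (L.continuous.comp (hcont (m + 1) hy))).aestronglyMeasurable
      (.of_forall fun s z hz => by
        rw [LinearIsometryEquiv.norm_map]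
        exact hC (s, z) ⟨mem_univ s, hz⟩)
      (integrable_const C)
      (.of_forall fun s z hz => by
        have hd : DifferentiableAt ℝ (iteratedFDeriv ℝ m (φ s)) z :=
          ((hφ s).contDiffAt (hΩ.mem_nhds (hrΩ hz))).differentiableAt_iteratedFDeriv
            (by exact_mod_cast WithTop.coe_lt_top m)
        exact hd.hasFDerivAt)
    refine h.congr_fderiv ?_
    exact (ContinuousLinearEquiv.integral_comp_comm (𝕜 := ℝ)
      (E := ContinuousMultilinearMap ℝ (fun _ : Fin (m + 1) => E) ℂ)
      (F := E →L[ℝ] ContinuousMultilinearMap ℝ (fun _ : Fin m => E) ℂ)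
      L.toContinuousLinearEquiv (μ := μ)
      (fun s => iteratedFDeriv ℝ (m + 1) (φ s) y))
  refine ⟨fun y hy => ?_, fun m _ y hy => (hderiv m hy).hasFDerivWithinAt,
    fun m _ y hy => (hderiv m hy).continuousAt.continuousWithinAt⟩
  have h := (continuousMultilinearCurryFin0 ℝ E ℂ).toContinuousLinearEquiv.integral_comp_comm
    (μ := μ) (fun s => iteratedFDeriv ℝ 0 (φ s) y)
  exact h.symm

lemma contDiffOn_integral (hΩ : IsOpen Ω) (hφ : ∀ s, ContDiffOn ℝ (⊤ : ℕ∞) (φ s) Ω)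
    (hc : ∀ i : ℕ, ContinuousOn (fun q : P × E => iteratedFDeriv ℝ i (φ q.1) q.2) (univ ×ˢ Ω)) :
    ContDiffOn ℝ (⊤ : ℕ∞) (fun y => ∫ s, φ s y ∂μ) Ω :=
  (hasFTaylorSeriesUpToOn_integral hΩ hφ hc).contDiffOn

lemma iteratedFDeriv_integral (hΩ : IsOpen Ω) (hφ : ∀ s, ContDiffOn ℝ (⊤ : ℕ∞) (φ s) Ω)
    (hc : ∀ i : ℕ, ContinuousOn (fun q : P × E => iteratedFDeriv ℝ i (φ q.1) q.2) (univ ×ˢ Ω))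
    (i : ℕ) {y : E} (hy : y ∈ Ω) :
    iteratedFDeriv ℝ i (fun y => ∫ s, φ s y ∂μ) y = ∫ s, iteratedFDeriv ℝ i (φ s) y ∂μ := by
  rw [← iteratedFDerivWithin_of_isOpen i hΩ hy]
  exact ((hasFTaylorSeriesUpToOn_integral hΩ hφ hc).eq_iteratedFDerivWithin_of_uniqueDiffOn
    (by exact_mod_cast le_top) hΩ.uniqueDiffOn hy).symm

end ParametricIntegral

end Colombeau

namespace Colombeau

/-- A linear functional bounded by the norm of a linear map `J` factors through `J` by a
continuous linear functional. -/
lemma exists_functional_comp_eq {V X : Type*} [AddCommGroup V] [Module ℂ V]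
    [NormedAddCommGroup X] [NormedSpace ℂ X] (J : V →ₗ[ℂ] X) (S : V →ₗ[ℂ] ℂ) (C : ℝ)
    (hbound : ∀ v, ‖S v‖ ≤ C * ‖J v‖) : ∃ L : X →L[ℂ] ℂ, ∀ v, L (J v) = S v := by
  have hker : S ∈ LinearMap.range J.dualMap := by
    rw [LinearMap.range_dualMap_eq_dualAnnihilator_ker, Submodule.mem_dualAnnihilator]
    intro v hv
    have h := hbound v
    rw [LinearMap.mem_ker.1 hv, norm_zero, mul_zero] at h
    exact norm_le_zero_iff.1 h
  obtain ⟨g, rfl⟩ := hker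
  let g₀ : LinearMap.range J →L[ℂ] ℂ :=
    (g ∘ₗ (LinearMap.range J).subtype).mkContinuous C (by
      rintro ⟨_, v, rfl⟩
      exact hbound v)
  obtain ⟨L, hL, -⟩ := exists_extension_norm_eq (LinearMap.range J) g₀
  exact ⟨L, fun v => hL ⟨J v, v, rfl⟩⟩

section Jets

variable {n : ℕ} {Ω : Set (Rn n)} {S : (Rn n → ℂ) →ₗ[ℂ] ℂ}

/-- Continuous `j`-jets on a compact set. -/
def Jets (K : TopologicalSpace.Compacts (Rn n)) (j : ℕ) :=
  ∀ i : Fin (j + 1), C(K, ContinuousMultilinearMap ℝ (fun _ : Fin i => Rn n) ℂ)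

instance (K : TopologicalSpace.Compacts (Rn n)) (j : ℕ) : NormedAddCommGroup (Jets K j) :=
  Pi.normedAddCommGroup

instance (K : TopologicalSpace.Compacts (Rn n)) (j : ℕ) : NormedSpace ℂ (Jets K j) :=
  Pi.normedSpace

instance (K : TopologicalSpace.Compacts (Rn n)) (j : ℕ) : NormedSpace ℝ (Jets K j) :=
  Pi.normedSpace

instance (K : TopologicalSpace.Compacts (Rn n)) (j : ℕ) : CompleteSpace (Jets K j) :=
  inferInstanceAs (CompleteSpace
    (∀ i : Fin (j + 1), C(K, ContinuousMultilinearMap ℝ (fun _ : Fin i => Rn n) ℂ)))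

lemma norm_apply_le_norm {K : TopologicalSpace.Compacts (Rn n)} {j : ℕ} (J : Jets K j)
    (i : Fin (j + 1)) : ‖J i‖ ≤ ‖J‖ :=
  norm_le_pi_norm (G := fun i : Fin (j + 1) =>
    C(K, ContinuousMultilinearMap ℝ (fun _ : Fin i => Rn n) ℂ)) J i

/-- The `i`-th component of a jet at a point. -/
def Jets.eval {K : TopologicalSpace.Compacts (Rn n)} {j : ℕ} (i : Fin (j + 1)) (y : K) :
    Jets K j →L[ℝ] ContinuousMultilinearMap ℝ (fun _ : Fin i => Rn n) ℂ :=
  (ContinuousMap.evalCLM ℝ y).comp (ContinuousLinearMap.proj (R := ℝ)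
    (φ := fun i : Fin (j + 1) => C(K, ContinuousMultilinearMap ℝ (fun _ : Fin i => Rn n) ℂ)) i)

lemma continuousOn_iteratedFDeriv {f : Rn n → ℂ} (hΩ : IsOpen Ω)
    (hf : ContDiffOn ℝ (⊤ : ℕ∞) f Ω) (i : ℕ) : ContinuousOn (iteratedFDeriv ℝ i f) Ω :=
  (hf.continuousOn_iteratedFDerivWithin (by exact_mod_cast le_top) hΩ.uniqueDiffOn).congr
    (iteratedFDerivWithin_of_isOpen i hΩ).symm

/-- The space of functions that are smooth on `Ω`. -/
def smoothOn (Ω : Set (Rn n)) : Submodule ℂ (Rn n → ℂ) where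
  carrier := {f | ContDiffOn ℝ (⊤ : ℕ∞) f Ω}
  add_mem' hf hg := ContDiffOn.add hf hg
  zero_mem' := contDiffOn_const
  smul_mem' c _ hf := ContDiffOn.const_smul c hf

/-- The map taking a function that is smooth on `Ω` to its `j`-jet on `K`. -/
def jet (hΩ : IsOpen Ω) (K : TopologicalSpace.Compacts (Rn n)) (hK : (K : Set (Rn n)) ⊆ Ω)
    (j : ℕ) : smoothOn Ω →ₗ[ℂ] Jets K j where
  toFun f i := ⟨fun y => iteratedFDeriv ℝ i f.1 y,
    ((continuousOn_iteratedFDeriv hΩ f.2 i).mono hK).domRestrict⟩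
  map_add' f g := by
    funext i
    refine ContinuousMap.ext fun y => ?_
    have hy := hΩ.mem_nhds (hK y.2)
    exact iteratedFDeriv_add_apply
      ((f.2.contDiffAt hy).of_le (by exact_mod_cast le_top))
      ((g.2.contDiffAt hy).of_le (by exact_mod_cast le_top))
  map_smul' c f := by
    funext i
    refine ContinuousMap.ext fun y => ?_
    have hy := hΩ.mem_nhds (hK y.2)
    exact iteratedFDeriv_const_smul_apply
      ((f.2.contDiffAt hy).of_le (by exact_mod_cast le_top))

/-- By the Hahn-Banach theorem, a compactly supported distribution is a continuous linear
functional of the jets of a finite order on a compact set. -/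
lemma exists_functional_jet (hΩ : IsOpen Ω) (hS : IsCptSuppDistributionOn Ω S) :
    ∃ (K : TopologicalSpace.Compacts (Rn n)) (hK : (K : Set (Rn n)) ⊆ Ω) (j : ℕ)
      (L : Jets K j →L[ℂ] ℂ), ∀ f : smoothOn Ω, L (jet hΩ K hK j f) = S f := by
  obtain ⟨K, hKc, hK, j, C, hC, hb⟩ := hS
  let K' : TopologicalSpace.Compacts (Rn n) := ⟨K, hKc⟩
  obtain ⟨L, hL⟩ := exists_functional_comp_eq (jet hΩ K' hK j)
    (S ∘ₗ (smoothOn Ω).subtype) C fun f => hb f f.2 _ fun x hx i hi =>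
      (((jet hΩ K' hK j f) ⟨i, Nat.lt_succ_of_le hi⟩).norm_coe_le_norm ⟨x, hx⟩).trans
        (norm_apply_le_norm _ _)
  exact ⟨K', hK, j, L, hL⟩

variable {P : Type} [TopologicalSpace P] {φ : P → Rn n → ℂ}

lemma continuous_jet (hΩ : IsOpen Ω) (hφ : ∀ s, φ s ∈ smoothOn Ω)
    (hc : ∀ i : ℕ, ContinuousOn (fun q : P × Rn n => iteratedFDeriv ℝ i (φ q.1) q.2)
      (univ ×ˢ Ω))
    (K : TopologicalSpace.Compacts (Rn n)) (hK : (K : Set (Rn n)) ⊆ Ω) (j : ℕ) :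
    Continuous fun s => jet hΩ K hK j ⟨φ s, hφ s⟩ := by
  refine continuous_pi fun i => ?_
  refine ContinuousMap.continuous_of_continuous_uncurry _ ?_
  exact (hc i).comp_continuous (f := fun q : P × K => (q.1, (q.2 : Rn n))) (by fun_prop)
    fun q => ⟨mem_univ _, hK q.2.2⟩

/-- A compactly supported distribution depends continuously on its argument. -/
lemma continuous_apply_of_smooth (hΩ : IsOpen Ω) (hS : IsCptSuppDistributionOn Ω S)
    (hφ : ∀ s, φ s ∈ smoothOn Ω)
    (hc : ∀ i : ℕ, ContinuousOn (fun q : P × Rn n => iteratedFDeriv ℝ i (φ q.1) q.2)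
      (univ ×ˢ Ω)) :
    Continuous fun s => S (φ s) := by
  obtain ⟨K, hK, j, L, hL⟩ := exists_functional_jet hΩ hS
  exact (L.continuous.comp (continuous_jet hΩ hφ hc K hK j)).congr fun s => hL ⟨φ s, hφ s⟩

/-- A compactly supported distribution commutes with integrals over a compact parameter space. -/
lemma apply_integral [CompactSpace P] [MeasurableSpace P] [OpensMeasurableSpace P]
    (μ : Measure P) [IsFiniteMeasure μ] (hΩ : IsOpen Ω) (hS : IsCptSuppDistributionOn Ω S)
    (hφ : ∀ s, φ s ∈ smoothOn Ω)
    (hc : ∀ i : ℕ, ContinuousOn (fun q : P × Rn n => iteratedFDeriv ℝ i (φ q.1) q.2)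
      (univ ×ˢ Ω)) :
    S (fun y => ∫ s, φ s y ∂μ) = ∫ s, S (φ s) ∂μ := by
  obtain ⟨K, hK, j, L, hL⟩ := exists_functional_jet hΩ hS
  have hint : Integrable (fun s => jet hΩ K hK j ⟨φ s, hφ s⟩) μ :=
    integrable_of_continuous (continuous_jet hΩ hφ hc K hK j)
  let F : smoothOn Ω := ⟨fun y => ∫ s, φ s y ∂μ, contDiffOn_integral hΩ hφ hc⟩
  have hF : jet hΩ K hK j F = ∫ s, jet hΩ K hK j ⟨φ s, hφ s⟩ ∂μ := by
    funext i
    refine ContinuousMap.ext fun y => ?_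
    exact (iteratedFDeriv_integral hΩ hφ hc i (hK y.2)).trans
      ((Jets.eval i y).integral_comp_comm hint)
  calc S (fun y => ∫ s, φ s y ∂μ) = L (jet hΩ K hK j F) := (hL F).symm
    _ = ∫ s, L (jet hΩ K hK j ⟨φ s, hφ s⟩) ∂μ := by rw [hF, L.integral_comp_comm hint]
    _ = ∫ s, S (φ s) ∂μ := integral_congr_ae (.of_forall fun s => hL ⟨φ s, hφ s⟩)

end Jets

end Colombeau

namespace Colombeau

section Kernels

variable {n : ℕ} {Ω : Set (Rn n)} {S : (Rn n → ℂ) →ₗ[ℂ] ℂ} {k : Rn n × Rn n → ℂ}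

/-- A compactly supported distribution on `Ω` only depends on the restriction to `Ω` of its
argument. -/
lemma apply_congr (hΩ : IsOpen Ω) (hS : IsCptSuppDistributionOn Ω S) {f g : Rn n → ℂ}
    (h : EqOn f g Ω) : S f = S g := by
  obtain ⟨K, -, hK, j, C, -, hb⟩ := hS
  have h0 : EqOn (f - g) (fun _ => 0) Ω := fun y hy => sub_eq_zero.2 (h hy)
  have hle := hb (f - g) (contDiffOn_const.congr h0) 0 fun x hx i _ => by
    rw [((h0.eventuallyEq_of_mem (hΩ.mem_nhds (hK hx))).iteratedFDeriv ℝ i).eq_of_nhds]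
    simp
  rw [mul_zero, norm_le_zero_iff, map_sub, sub_eq_zero] at hle
  exact hle

lemma continuousOn_apply_slice (hΩ : IsOpen Ω) (hS : IsCptSuppDistributionOn Ω S)
    (hk : ContDiffOn ℝ (⊤ : ℕ∞) k (Ω ×ˢ Ω)) :
    ContinuousOn (fun x => S fun y => k (x, y)) Ω := by
  rw [continuousOn_iff_continuous_domRestrict]
  refine continuous_apply_of_smooth (φ := fun (x : Ω) y => k (x, y)) hΩ hS
    (fun x => contDiffOn_slice hk x.2) fun i => ?_
  exact (continuousOn_iteratedFDeriv_slice hΩ hk i).comp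
    (f := fun q : Ω × Rn n => ((q.1 : Rn n), q.2)) (by fun_prop) fun q hq => ⟨q.1.2, hq.2⟩

lemma apply_setIntegral_slice {P : Type} [TopologicalSpace P] [T2Space P] [MeasurableSpace P]
    [BorelSpace P] (μ : Measure P) [IsFiniteMeasureOnCompacts μ] (hΩ : IsOpen Ω)
    (hS : IsCptSuppDistributionOn Ω S) (hk : ContDiffOn ℝ (⊤ : ℕ∞) k (Ω ×ˢ Ω)) {A : Set P}
    (hA : IsCompact A) {γ : P → Rn n} (hγ : ContinuousOn γ A) (hγΩ : MapsTo γ A Ω) {w : P → ℂ}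
    (hw : ContinuousOn w A) :
    S (fun y => ∫ s in A, k (γ s, y) * w s ∂μ) =
      ∫ s in A, S (fun y => k (γ s, y)) * w s ∂μ := by
  have : CompactSpace A := isCompact_iff_compactSpace.1 hA
  have : IsFiniteMeasure (μ.comap (Subtype.val : A → P)) := by
    refine ⟨?_⟩
    rw [comap_subtype_coe_apply hA.measurableSet, image_univ, Subtype.range_coe]
    exact hA.measure_lt_top
  have hs : ∀ s : A, ContDiffOn ℝ (⊤ : ℕ∞) (fun y => k (γ s, y)) Ω := fun s =>
    contDiffOn_slice hk (hγΩ s.2)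
  have h := apply_integral (μ.comap (Subtype.val : A → P)) (S := S)
    (φ := fun s : A => w s • fun y => k (γ s, y)) hΩ hS (fun s => (smoothOn Ω).smul_mem (w s) (hs s)) fun i => by
      have h1 : ContinuousOn
          (fun q : A × Rn n => iteratedFDeriv ℝ i (fun y => k (γ q.1, y)) q.2) (univ ×ˢ Ω) :=
        (continuousOn_iteratedFDeriv_slice hΩ hk i).comp
          (f := fun q : A × Rn n => (γ q.1, q.2))
          (((hγ.domRestrict).comp continuous_fst).prodMk continuous_snd).continuousOn
          fun q hq => ⟨hγΩ q.1.2, hq.2⟩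
      refine (((hw.domRestrict.comp continuous_fst).continuousOn).smul h1).congr fun q hq => ?_
      exact iteratedFDeriv_const_smul_apply
        (((hs q.1).contDiffAt (hΩ.mem_nhds hq.2)).of_le (by exact_mod_cast le_top))
  simp only [map_smul, Pi.smul_apply, smul_eq_mul] at h
  rw [← integral_subtype_comap hA.measurableSet]
  simp_rw [← integral_subtype_comap hA.measurableSet, mul_comm _ (w _)]
  exact h

lemma contDiffOn_fderiv_apply {E : Type} [NormedAddCommGroup E] [NormedSpace ℝ E] {U : Set E}
    (hU : IsOpen U) {f : E → ℂ} (hf : ContDiffOn ℝ (⊤ : ℕ∞) f U) (w : E) :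
    ContDiffOn ℝ (⊤ : ℕ∞) (fun p => fderiv ℝ f p w) U :=
  (hf.fderiv_of_isOpen hU (by simp)).clm_apply contDiffOn_const

/-- The candidate for the derivative of `x ↦ S (k (x, ·))`. -/
def applyFDeriv (S : (Rn n → ℂ) →ₗ[ℂ] ℂ) (k : Rn n × Rn n → ℂ) (x : Rn n) : Rn n →L[ℝ] ℂ :=
  LinearMap.toContinuousLinearMap
    { toFun := fun v => S fun y => fderiv ℝ k (x, y) (v, 0)
      map_add' := fun v w => by
        rw [← map_add]
        congr 1
        funext y
        rw [Pi.add_apply, ← map_add, Prod.mk_add_mk, add_zero]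
      map_smul' := fun c v => by
        have : (fun y => fderiv ℝ k (x, y) (c • v, 0)) =
            (c : ℂ) • fun y => fderiv ℝ k (x, y) (v, 0) := by
          funext y
          rw [Pi.smul_apply, Complex.coe_smul, ← map_smul, Prod.smul_mk, smul_zero]
        rw [this, map_smul, Complex.coe_smul, RingHom.id_apply] }

lemma applyFDeriv_apply (x v : Rn n) :
    applyFDeriv S k x v = S fun y => fderiv ℝ k (x, y) (v, 0) := rfl

lemma continuousOn_applyFDeriv (hΩ : IsOpen Ω) (hS : IsCptSuppDistributionOn Ω S)
    (hk : ContDiffOn ℝ (⊤ : ℕ∞) k (Ω ×ˢ Ω)) : ContinuousOn (applyFDeriv S k) Ω :=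
  continuousOn_clm_apply.2 fun v =>
    continuousOn_apply_slice hΩ hS (contDiffOn_fderiv_apply (hΩ.prod hΩ) hk (v, 0))

lemma apply_slice_sub (hΩ : IsOpen Ω) (hS : IsCptSuppDistributionOn Ω S)
    (hk : ContDiffOn ℝ (⊤ : ℕ∞) k (Ω ×ˢ Ω)) {x v : Rn n}
    (hxv : MapsTo (fun s : ℝ => x + s • v) (Icc 0 1) Ω) :
    S (fun y => k (x + v, y)) - S (fun y => k (x, y)) =
      ∫ s in Icc (0 : ℝ) 1, applyFDeriv S k (x + s • v) v := by
  have hk' := contDiffOn_fderiv_apply (hΩ.prod hΩ) hk (v, 0)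
  have h := apply_setIntegral_slice volume hΩ hS hk' isCompact_Icc
    (γ := fun s : ℝ => x + s • v) (by fun_prop) hxv (w := fun _ => 1) continuousOn_const
  simp only [mul_one] at h
  simp_rw [applyFDeriv_apply]
  rw [← h, ← map_sub]
  refine apply_congr hΩ hS fun y hy => ?_
  have hd : ∀ s ∈ uIcc (0 : ℝ) 1, HasDerivAt (fun s : ℝ => k (x + s • v, y))
      (fderiv ℝ k (x + s • v, y) (v, 0)) s := by
    intro s hs
    rw [uIcc_of_le zero_le_one] at hs
    have h1 : HasFDerivAt k (fderiv ℝ k (x + s • v, y)) (x + s • v, y) :=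
      ((hk.contDiffAt ((hΩ.prod hΩ).mem_nhds ⟨hxv hs, hy⟩)).differentiableAt
        (by simp)).hasFDerivAt
    have h2 : HasDerivAt (fun s : ℝ => (x + s • v, y)) (v, (0 : Rn n)) s := by
      simpa using (((hasDerivAt_id s).smul_const v).const_add x).prodMk (hasDerivAt_const s y)
    exact h1.comp_hasDerivAt s h2
  have hi : ContinuousOn (fun s : ℝ => fderiv ℝ k (x + s • v, y) (v, 0)) (uIcc (0 : ℝ) 1) := by
    rw [uIcc_of_le zero_le_one]
    exact hk'.continuousOn.comp (f := fun s : ℝ => (x + s • v, y)) (by fun_prop)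
      fun s hs => ⟨hxv hs, hy⟩
  have := intervalIntegral.integral_eq_sub_of_hasDerivAt hd hi.intervalIntegrable
  rw [integral_Icc_eq_integral_Ioc, ← intervalIntegral.integral_of_le zero_le_one, this]
  simp

lemma hasFDerivAt_apply_slice (hΩ : IsOpen Ω) (hS : IsCptSuppDistributionOn Ω S)
    (hk : ContDiffOn ℝ (⊤ : ℕ∞) k (Ω ×ˢ Ω)) {x : Rn n} (hx : x ∈ Ω) :
    HasFDerivAt (fun x => S fun y => k (x, y)) (applyFDeriv S k x) x := by
  have hD := continuousOn_applyFDeriv hΩ hS hk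
  rw [hasFDerivAt_iff_isLittleO_nhds_zero, Asymptotics.isLittleO_iff]
  intro c hc
  have hnear : ∀ᶠ z in 𝓝 x, z ∈ Ω ∧ ‖applyFDeriv S k z - applyFDeriv S k x‖ < c := by
    refine (hΩ.eventually_mem hx).and ?_
    filter_upwards [(hD.continuousAt (hΩ.mem_nhds hx)).eventually (Metric.ball_mem_nhds _ hc)]
      with z hz
    rwa [← dist_eq_norm]
  obtain ⟨r, hr, hball⟩ := Metric.eventually_nhds_iff_ball.1 hnear
  filter_upwards [Metric.ball_mem_nhds (0 : Rn n) hr] with v hv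
  have hseg : ∀ s ∈ Icc (0 : ℝ) 1, x + s • v ∈ Metric.ball x r := by
    intro s hs
    rw [mem_ball_zero_iff] at hv
    rw [mem_ball_iff_norm, add_sub_cancel_left, norm_smul, Real.norm_of_nonneg hs.1]
    exact (mul_le_of_le_one_left (norm_nonneg v) hs.2).trans_lt hv
  have hmaps : MapsTo (fun s : ℝ => x + s • v) (Icc 0 1) Ω := fun s hs => (hball _ (hseg s hs)).1
  have hint : IntegrableOn (fun s : ℝ => applyFDeriv S k (x + s • v) v) (Icc 0 1) :=
    ContinuousOn.integrableOn_compact isCompact_Icc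
      ((hD.comp (by fun_prop) hmaps).clm_apply continuousOn_const)
  have hconst : applyFDeriv S k x v = ∫ _ in Icc (0 : ℝ) 1, applyFDeriv S k x v := by simp
  rw [apply_slice_sub hΩ hS hk hmaps, hconst,
    ← integral_sub hint (integrableOn_const (by simp))]
  refine (norm_setIntegral_le_of_norm_le_const (C := c * ‖v‖) (by simp) fun s hs => ?_).trans
    (by simp)
  exact ((applyFDeriv S k (x + s • v) - applyFDeriv S k x).le_opNorm v).trans
    (mul_le_mul_of_nonneg_right (hball _ (hseg s hs)).2.le (norm_nonneg v))

lemma contDiffOn_apply_slice (hΩ : IsOpen Ω) (hS : IsCptSuppDistributionOn Ω S)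
    (hk : ContDiffOn ℝ (⊤ : ℕ∞) k (Ω ×ˢ Ω)) :
    ContDiffOn ℝ (⊤ : ℕ∞) (fun x => S fun y => k (x, y)) Ω := by
  rw [contDiffOn_infty]
  intro m
  induction m generalizing k with
  | zero => exact contDiffOn_zero.2 (continuousOn_apply_slice hΩ hS hk)
  | succ m ih =>
    push_cast
    refine (contDiffOn_succ_iff_fderiv_of_isOpen hΩ).2
      ⟨fun x hx => (hasFDerivAt_apply_slice hΩ hS hk hx).differentiableAt.differentiableWithinAt,
        by simp, contDiffOn_clm_apply.2 fun v => ?_⟩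
    refine (ih (contDiffOn_fderiv_apply (hΩ.prod hΩ) hk (v, 0))).congr fun x hx => ?_
    rw [(hasFDerivAt_apply_slice hΩ hS hk hx).fderiv, applyFDeriv_apply]

end Kernels

end Colombeau

namespace Colombeau

section Moderate

/-- A net of functions is bounded on `K` by a negative power of `ε`. -/
def HasModerateBound {E : Type} (K : Set E) (f : ℝ → E → ℝ) : Prop :=
  ∃ N : ℕ, ∃ c > 0, ∃ η ∈ Ioc (0:ℝ) 1, ∀ ε ∈ Ioc (0:ℝ) η, ∀ x ∈ K,
    f ε x ≤ c * ε ^ (-(N:ℝ))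

section Bounds

variable {E : Type} {K : Set E} {f g : ℝ → E → ℝ}

lemma HasModerateBound.mono (hg : HasModerateBound K g)
    (h : ∀ ε ∈ Ioc (0:ℝ) 1, ∀ x ∈ K, f ε x ≤ g ε x) : HasModerateBound K f := by
  obtain ⟨N, c, hc, η, hη, hb⟩ := hg
  exact ⟨N, c, hc, η, hη, fun ε hε x hx =>
    (h ε ⟨hε.1, hε.2.trans hη.2⟩ x hx).trans (hb ε hε x hx)⟩

lemma HasModerateBound.add (hf : HasModerateBound K f) (hg : HasModerateBound K g) :
    HasModerateBound K fun ε x => f ε x + g ε x := by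
  obtain ⟨N, c, hc, η, hη, hb⟩ := hf
  obtain ⟨N', c', hc', η', hη', hb'⟩ := hg
  refine ⟨N + N', c + c', by positivity, min η η',
    ⟨lt_min hη.1 hη'.1, (min_le_left _ _).trans hη.2⟩, fun ε hε x hx => ?_⟩
  have h1 : ε ≤ 1 := (hε.2.trans (min_le_left _ _)).trans hη.2
  have h := hb ε ⟨hε.1, hε.2.trans (min_le_left _ _)⟩ x hx
  have h' := hb' ε ⟨hε.1, hε.2.trans (min_le_right _ _)⟩ x hx
  have hN : ε ^ (-(N:ℝ)) ≤ ε ^ (-((N + N' : ℕ):ℝ)) :=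
    Real.rpow_le_rpow_of_exponent_ge hε.1 h1 (by push_cast; linarith [N'.cast_nonneg (α := ℝ)])
  have hN' : ε ^ (-(N':ℝ)) ≤ ε ^ (-((N + N' : ℕ):ℝ)) :=
    Real.rpow_le_rpow_of_exponent_ge hε.1 h1 (by push_cast; linarith [N.cast_nonneg (α := ℝ)])
  rw [add_mul]
  exact add_le_add (h.trans (by gcongr)) (h'.trans (by gcongr))

lemma HasModerateBound.const_mul (hf : HasModerateBound K f) {a : ℝ} (ha : 0 ≤ a) :
    HasModerateBound K fun ε x => a * f ε x := by
  obtain ⟨N, c, hc, η, hη, hb⟩ := hf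
  refine ⟨N, (a + 1) * c, by positivity, η, hη, fun ε hε x hx => ?_⟩
  have hpos : 0 ≤ c * ε ^ (-(N:ℝ)) := mul_nonneg hc.le (Real.rpow_nonneg hε.1.le _)
  nlinarith [mul_le_mul_of_nonneg_left (hb ε hε x hx) ha]

lemma HasModerateBound.sum {ι : Type*} (s : Finset ι) {f : ι → ℝ → E → ℝ}
    (hf : ∀ i ∈ s, HasModerateBound K (f i)) :
    HasModerateBound K fun ε x => ∑ i ∈ s, f i ε x := by
  classical
  induction s using Finset.induction_on with
  | empty =>
    refine ⟨0, 1, one_pos, 1, ⟨one_pos, le_rfl⟩, fun ε hε x _ => ?_⟩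
    simp
  | insert a s ha ih =>
    simp_rw [Finset.sum_insert ha]
    exact (hf a (Finset.mem_insert_self a s)).add
      (ih fun i hi => hf i (Finset.mem_insert_of_mem hi))

end Bounds

lemma IsModerate.fderiv_apply {E : Type} [NormedAddCommGroup E] [NormedSpace ℝ E] {U : Set E}
    (hU : IsOpen U) {f : ℝ → E → ℂ} (hf : IsModerate U f) (w : E) :
    IsModerate U fun ε p => fderiv ℝ (f ε) p w := by
  refine ⟨fun ε hε => contDiffOn_fderiv_apply hU (hf.1 ε hε) w, fun K hK hKU i => ?_⟩
  have h : HasModerateBound K fun ε x => ‖iteratedFDeriv ℝ (i + 1) (f ε) x‖ :=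
    hf.2 K hK hKU (i + 1)
  refine (h.const_mul (norm_nonneg w)).mono fun ε hε x hx => ?_
  rw [← norm_iteratedFDeriv_fderiv]
  exact norm_iteratedFDeriv_clm_apply_const (N := (⊤ : ℕ∞))
    (((hf.1 ε hε).fderiv_of_isOpen hU (by simp)).contDiffAt (hU.mem_nhds (hKU hx)))
    (by exact_mod_cast le_top)

variable {n : ℕ}

/-- The map taking `z` to the functional `v ↦ v i • z`. -/
def coordSmulRight (i : Fin n) : ℂ →L[ℝ] Rn n →L[ℝ] ℂ :=
  ContinuousLinearMap.smulRightL ℝ (Rn n) ℂ (EuclideanSpace.proj i)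

lemma norm_iteratedFDeriv_clm_le {F : Rn n → Rn n →L[ℝ] ℂ} {x : Rn n} {m : ℕ}
    (hF : ContDiffAt ℝ m F x) :
    ‖iteratedFDeriv ℝ m F x‖ ≤ ∑ i, ‖coordSmulRight i‖ *
      ‖iteratedFDeriv ℝ m (fun z => F z (EuclideanSpace.single i 1)) x‖ := by
  have hFi : ∀ i, ContDiffAt ℝ m (fun z => F z (EuclideanSpace.single i 1)) x := fun i =>
    hF.clm_apply contDiffAt_const
  have hsum : F = ∑ i, coordSmulRight i ∘ fun z => F z (EuclideanSpace.single i 1) := by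
    funext z
    refine ContinuousLinearMap.ext fun v => ?_
    conv_lhs => rw [← (EuclideanSpace.basisFun (Fin n) ℝ).sum_repr v]
    simp [coordSmulRight]
  conv_lhs => rw [hsum]
  rw [iteratedFDeriv_sum_apply fun i _ => (coordSmulRight i).contDiff.contDiffAt.comp x (hFi i)]
  exact (norm_sum_le _ _).trans (Finset.sum_le_sum fun i _ =>
    (coordSmulRight i).norm_iteratedFDeriv_comp_left (hFi i) le_rfl)

variable {Ω : Set (Rn n)} {k : ℝ → Rn n × Rn n → ℂ} {T : ℝ → (Rn n → ℂ) →ₗ[ℂ] ℂ}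

lemma hasModerateBound_apply_slice (hΩ : IsOpen Ω) (hk : IsModerate (Ω ×ˢ Ω) k)
    (hT : IsBasicNetE Ω T) {K : Set (Rn n)} (hK : IsCompact K) (hKΩ : K ⊆ Ω) :
    HasModerateBound K fun ε x => ‖T ε fun y => k ε (x, y)‖ := by
  obtain ⟨-, K', hK', hK'Ω, j, N, η, hη, hb⟩ := hT
  have hsum : HasModerateBound (K ×ˢ K') fun ε p =>
      ∑ i ∈ Finset.range (j + 1), ‖iteratedFDeriv ℝ i (k ε) p‖ :=
    HasModerateBound.sum _ fun i _ => hk.2 _ (hK.prod hK') (prod_mono hKΩ hK'Ω) i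
  obtain ⟨N', c, hc, η', hη', hb'⟩ := hsum
  refine ⟨N + N', c, hc, min η η', ⟨lt_min hη.1 hη'.1, (min_le_left _ _).trans hη.2⟩,
    fun ε hε x hx => ?_⟩
  have hε1 : ε ∈ Ioc (0:ℝ) 1 := ⟨hε.1, (hε.2.trans (min_le_left _ _)).trans hη.2⟩
  have hkε := hk.1 ε hε1
  refine (hb ε ⟨hε.1, hε.2.trans (min_le_left _ _)⟩ (fun y => k ε (x, y))
    (contDiffOn_slice hkε (hKΩ hx)) (c * ε ^ (-(N':ℝ)))
    (mul_nonneg hc.le (Real.rpow_nonneg hε.1.le _)) fun y hy i hi => ?_).trans (le_of_eq ?_)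
  · refine (norm_iteratedFDeriv_slice_le hΩ hkε (hKΩ hx) (hK'Ω hy) i).trans
      (le_trans ?_ (hb' ε ⟨hε.1, hε.2.trans (min_le_right _ _)⟩ (x, y) ⟨hx, hy⟩))
    exact Finset.single_le_sum (f := fun i => ‖iteratedFDeriv ℝ i (k ε) (x, y)‖)
      (fun _ _ => norm_nonneg _) (Finset.mem_range_succ_iff.2 hi)
  · rw [mul_left_comm, ← Real.rpow_add hε.1]
    push_cast
    ring_nf

/-- A basic functional maps a moderate kernel to a moderate net. -/
lemma isModerate_apply_slice (hΩ : IsOpen Ω) (hk : IsModerate (Ω ×ˢ Ω) k)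
    (hT : IsBasicNetE Ω T) : IsModerate Ω fun ε x => T ε fun y => k ε (x, y) := by
  refine ⟨fun ε hε => contDiffOn_apply_slice hΩ (hT.1 ε hε) (hk.1 ε hε), fun K hK hKΩ i => ?_⟩
  change HasModerateBound K fun ε x => ‖iteratedFDeriv ℝ i (fun x => T ε fun y => k ε (x, y)) x‖
  induction i generalizing k with
  | zero => simpa only [norm_iteratedFDeriv_zero] using hasModerateBound_apply_slice hΩ hk hT hK hKΩ
  | succ m ih =>
    refine (HasModerateBound.sum Finset.univ fun i _ =>
      (ih (hk.fderiv_apply (hΩ.prod hΩ) (EuclideanSpace.single i 1, 0))).const_mul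
        (norm_nonneg (coordSmulRight i))).mono fun ε hε x hx => ?_
    have hg := contDiffOn_apply_slice hΩ (hT.1 ε hε) (hk.1 ε hε)
    rw [← norm_iteratedFDeriv_fderiv]
    refine (norm_iteratedFDeriv_clm_le (((hg.fderiv_of_isOpen hΩ (m := (⊤ : ℕ∞))
      (by simp)).contDiffAt (hΩ.mem_nhds (hKΩ hx))).of_le (by exact_mod_cast le_top))).trans_eq ?_
    refine Finset.sum_congr rfl fun i _ => ?_
    have he : (fun z => fderiv ℝ (fun x => T ε fun y => k ε (x, y)) z
        (EuclideanSpace.single i 1)) =ᶠ[𝓝 x]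
        fun z => T ε fun y => fderiv ℝ (k ε) (z, y) (EuclideanSpace.single i 1, 0) := by
      filter_upwards [hΩ.mem_nhds (hKΩ hx)] with z hz
      rw [(hasFDerivAt_apply_slice hΩ (hT.1 ε hε) (hk.1 ε hε) hz).fderiv, applyFDeriv_apply]
    rw [(he.iteratedFDeriv ℝ m).eq_of_nhds]

end Moderate

/-- A compactly supported distribution commutes with the integral of a kernel against a
compactly supported function. -/
lemma apply_integral_mul {n : ℕ} {Ω : Set (Rn n)} {S : (Rn n → ℂ) →ₗ[ℂ] ℂ}
    {k : Rn n × Rn n → ℂ} (hΩ : IsOpen Ω) (hS : IsCptSuppDistributionOn Ω S)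
    (hk : ContDiffOn ℝ (⊤ : ℕ∞) k (Ω ×ˢ Ω)) {u : Rn n → ℂ} (hu : ContinuousOn u Ω)
    {K : Set (Rn n)} (hK : IsCompact K) (hKΩ : K ⊆ Ω) (huK : tsupport u ⊆ K) :
    S (fun y => ∫ x, k (x, y) * u x) = ∫ x, S (fun y => k (x, y)) * u x := by
  have h0 : ∀ x ∉ K, u x = 0 := fun x hx => image_eq_zero_of_notMem_tsupport fun h => hx (huK h)
  have h := apply_setIntegral_slice volume hΩ hS hk hK (γ := id) continuousOn_id hKΩ
    (hu.mono hKΩ)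
  simp only [id] at h
  rw [setIntegral_eq_integral_of_forall_compl_eq_zero fun x hx => by rw [h0 x hx, mul_zero]] at h
  rw [← h]
  congr 1
  funext y
  exact (setIntegral_eq_integral_of_forall_compl_eq_zero fun x hx => by
    rw [h0 x hx, mul_zero]).symm

end Colombeau

/-- Let `k_R ∈ G(Ω×Ω)` and let `R : G_c(Ω) → G(Ω)` be the integral
operator `Ru(x) = ∫ k_R(x,y)u(y)dy`, with transpose `ᵗRu(y) = ∫ k_R(x,y)u(x)dx`; extend
`R` to `L(G(Ω),ℂ̃)` by `RT(u) := T(ᵗRu)`.  If `T ∈ L(G(Ω),ℂ̃)` is basic, then `RT` is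
the generalized function `x ↦ T(k_R(x,·)) ∈ G(Ω)`:
`RT(u) = ∫ T(k_R(x,·))u(x)dx` for all `u ∈ G_c(Ω)`.  In particular operators with kernel
in `G(Ω×Ω)` map basic functionals of `L(G(Ω),ℂ̃)` into `G(Ω)`. -/
theorem statement11
    {n : ℕ} (Ω : Set (Rn n)) (hΩ : IsOpen Ω)
    (k : ℝ → (Rn n × Rn n) → ℂ) (hk : IsModerate (Ω ×ˢ Ω) k)
    (T : ℝ → (Rn n → ℂ) →ₗ[ℂ] ℂ) (hT : IsBasicNetE Ω T) :
    -- `x ↦ T(k_R(x,·))` is a Colombeau function in `G(Ω)`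
    IsModerate Ω (fun ε x => T ε (fun y => k ε (x, y))) ∧
    -- `RT` coincides with it: for every `u ∈ G_c(Ω)`, `T(ᵗRu) = ∫ T(k_R(x,·)) u(x) dx`
    (∀ u : ℝ → Rn n → ℂ, IsModerate Ω u → HasCmpSupp Ω u →
      CIsNegligible (fun ε =>
        T ε (fun y => ∫ x : Rn n, k ε (x, y) * u ε x) -
          ∫ x : Rn n, T ε (fun y => k ε (x, y)) * u ε x)) := by
  refine ⟨isModerate_apply_slice hΩ hk hT, fun u hu ⟨K, hK, hKΩ, huK⟩ q => ?_⟩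
  refine ⟨1, one_pos, 1, ⟨one_pos, le_rfl⟩, fun ε hε => ?_⟩
  beta_reduce
  rw [apply_integral_mul hΩ (hT.1 ε hε) (hk.1 ε hε) (hu.1 ε hε).continuousOn hK hKΩ (huK ε hε),
    sub_self, norm_zero, one_mul]
  exact Real.rpow_nonneg hε.1.le _
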